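/- arXiv:2503.09558 — 2 statements merged into one kernel-verified Lean document; each statement's English description precedes it below -/
import Mathlib

section
/- Linear relation between vertex Dodgson polynomials and contraction. Let G be a connected graph with positive Schwinger parameters, and let e = e_k be an edge whose tail s(e) = v_i and head t(e) = v_j are distinct vertices, both different from v⋆. Then a_k · ψ_{G/e} = ψ^{v_i,v_i} + ψ^{v_j,v_j} − 2(−1)^{i+j} ψ^{v_i,v_j}, where ψ_{G/e} denotes det 𝕄 evaluated with a_k replaced by 0. -/
open Matrix BigOperators

namespace GraphForms

/-- Vertices `x` and `y` are connected using only edges in `T` (in either direction). -/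
def Conn (m n : ℕ) (s t : Fin m → Fin n) (T : Set (Fin m)) (x y : Fin n) : Prop :=
  Relation.ReflTransGen
    (fun a b => ∃ e ∈ T, (s e = a ∧ t e = b) ∨ (s e = b ∧ t e = a)) x y

/-- The graph is connected. -/
def IsConnectedGraph (m n : ℕ) (s t : Fin m → Fin n) : Prop :=
  ∀ x y, Conn m n s t Set.univ x y

/-- `T ⊆ E` is a spanning tree: it has `n - 1` edges and connects all vertices. -/
def IsSpanningTree (m n : ℕ) (s t : Fin m → Fin n) (T : Finset (Fin m)) : Prop :=
  T.card = n - 1 ∧ ∀ x y, Conn m n s t ↑T x y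

/-- The reduced vertex incidence matrix `𝕀` (the distinguished vertex is the last one). -/
def inc (R : Type*) [Ring R] (m n' : ℕ) (s t : Fin m → Fin (n' + 1)) :
    Matrix (Fin m) (Fin n') R :=
  Matrix.of fun e j =>
    (if t e = Fin.castSucc j then (1 : R) else 0) -
      (if s e = Fin.castSucc j then (1 : R) else 0)

/-- `C` is a cycle incidence matrix: its columns lie in, and form a `ℤ`-basis of,
the lattice `{x : ℤ^E | 𝕀ᵀ x = 0}`. -/
def IsCycleMatrix (m n' ℓ : ℕ) (s t : Fin m → Fin (n' + 1))
    (C : Matrix (Fin m) (Fin ℓ) ℤ) : Prop :=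
  (inc ℤ m n' s t)ᵀ * C = 0 ∧
    ∀ x : Fin m → ℤ, (inc ℤ m n' s t)ᵀ.mulVec x = 0 →
      ∃! c : Fin ℓ → ℤ, C.mulVec c = x

/-- The concatenation `[X|Y]` of the columns of `X` and of `Y`, a square matrix. -/
def concat {R : Type*} {m ℓ c : ℕ} (h : ℓ + c = m) (X : Matrix (Fin m) (Fin ℓ) R)
    (Y : Matrix (Fin m) (Fin c) R) : Matrix (Fin m) (Fin m) R :=
  Matrix.of fun i j => Sum.elim (X i) (Y i) (finSumFinEquiv.symm (Fin.cast h.symm j))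

/-- The row submatrix `X[S]` (rows of `S` taken in increasing order);
junk value `0` if `S.card ≠ k`. -/
noncomputable def rowSub {R : Type*} [Zero R] {m c : ℕ} (X : Matrix (Fin m) (Fin c) R)
    (S : Finset (Fin m)) (k : ℕ) : Matrix (Fin k) (Fin c) R :=
  if h : S.card = k then Matrix.of fun i j => X ((S.orderIsoOfFin h) i : Fin m) j else 0

/-- The expanded vertex Laplacian `𝕄`, rows/columns indexed by edges and then vertices. -/
def MM (m n' : ℕ) (s t : Fin m → Fin (n' + 1)) (a : Fin m → ℝ) :
    Matrix (Fin (m + n')) (Fin (m + n')) ℝ :=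
  Matrix.of fun i j =>
    Matrix.fromBlocks (Matrix.diagonal a) (inc ℝ m n' s t) (-(inc ℝ m n' s t)ᵀ) 0
      (finSumFinEquiv.symm i) (finSumFinEquiv.symm j)

/-- The Symanzik polynomial `ψ_G = det 𝕄`. -/
noncomputable def psi (m n' : ℕ) (s t : Fin m → Fin (n' + 1)) (a : Fin m → ℝ) : ℝ :=
  (MM m n' s t a).det

/-- The Dodgson polynomial `ψ^{A,B}`: delete the rows in `A` and the columns in `B`
from `𝕄` (keeping the induced order) and take the determinant. -/
noncomputable def dodgson (m n' : ℕ) (s t : Fin m → Fin (n' + 1)) (a : Fin m → ℝ)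
    (A B : Finset (Fin (m + n'))) : ℝ :=
  if h : A.card = B.card then
    Matrix.det (Matrix.of fun i j : Fin (m + n' - A.card) =>
      MM m n' s t a
        ((Aᶜ.orderIsoOfFin (by simp [Finset.card_compl]) i : Fin (m + n')))
        ((Bᶜ.orderIsoOfFin (by simp [Finset.card_compl, h]) j : Fin (m + n'))))
  else 0

/-- Index of the edge `i` among the rows/columns of `𝕄`. -/
def edgeIdx (m n' : ℕ) (i : Fin m) : Fin (m + n') := Fin.castAdd n' i

/-- Index of the vertex `j` among the rows/columns of `𝕄`. -/
def vtxIdx (m n' : ℕ) (j : Fin n') : Fin (m + n') := Fin.natAdd m j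

/-- The edge Dodgson polynomial `ψ^{e_i,e_j}`. -/
noncomputable def dodgE (m n' : ℕ) (s t : Fin m → Fin (n' + 1)) (a : Fin m → ℝ)
    (i j : Fin m) : ℝ :=
  dodgson m n' s t a {edgeIdx m n' i} {edgeIdx m n' j}

/-- The vertex Dodgson polynomial `ψ^{v_i,v_j}`. -/
noncomputable def dodgV (m n' : ℕ) (s t : Fin m → Fin (n' + 1)) (a : Fin m → ℝ)
    (i j : Fin n') : ℝ :=
  dodgson m n' s t a {vtxIdx m n' i} {vtxIdx m n' j}

/-- The vertex Laplacian `L = 𝕀ᵀ D⁻¹ 𝕀`. -/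
noncomputable def vertexLap (m n' : ℕ) (s t : Fin m → Fin (n' + 1)) (a : Fin m → ℝ) :
    Matrix (Fin n') (Fin n') ℝ :=
  (inc ℝ m n' s t)ᵀ * Matrix.diagonal (fun i => (a i)⁻¹) * inc ℝ m n' s t

/-- The cycle Laplacian `Λ = 𝒞ᵀ D 𝒞`. -/
def cycleLap {m ℓ : ℕ} (a : Fin m → ℝ) (C : Matrix (Fin m) (Fin ℓ) ℤ) :
    Matrix (Fin ℓ) (Fin ℓ) ℝ :=
  (C.map (Int.cast : ℤ → ℝ))ᵀ * Matrix.diagonal a * C.map (Int.cast : ℤ → ℝ)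

/-- The degree-one generators `θ_i` of the exterior algebra `Ω`. -/
noncomputable def θ (m : ℕ) (i : Fin m) : ExteriorAlgebra ℝ (Fin m → ℝ) :=
  ExteriorAlgebra.ι ℝ (Pi.single i 1)

/-- The Pfaffian of a `2k × 2k` matrix with entries in the exterior algebra. -/
noncomputable def pfaffian {m N k : ℕ} (hk : N = 2 * k)
    (X : Matrix (Fin N) (Fin N) (ExteriorAlgebra ℝ (Fin m → ℝ))) :
    ExteriorAlgebra ℝ (Fin m → ℝ) :=
  ((2 ^ k * (Nat.factorial k : ℝ))⁻¹) •
    ∑ σ : Equiv.Perm (Fin N), (((Equiv.Perm.sign σ : ℤ) : ℝ)) •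
      (List.ofFn fun i : Fin k =>
        X (σ (Fin.cast hk.symm ⟨2 * i.1, by have := i.2; omega⟩))
          (σ (Fin.cast hk.symm ⟨2 * i.1 + 1, by have := i.2; omega⟩))).prod

/-- `dΛ = 𝒞ᵀ Θ 𝒞`, with `Θ = diag(θ_1, ..., θ_m)`, in the exterior algebra. -/
noncomputable def dLam {m ℓ : ℕ} (C : Matrix (Fin m) (Fin ℓ) ℤ) :
    Matrix (Fin ℓ) (Fin ℓ) (ExteriorAlgebra ℝ (Fin m → ℝ)) :=
  (C.map fun z => algebraMap ℝ (ExteriorAlgebra ℝ (Fin m → ℝ)) (z : ℝ))ᵀ *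
    Matrix.diagonal (θ m) *
    C.map fun z => algebraMap ℝ (ExteriorAlgebra ℝ (Fin m → ℝ)) (z : ℝ)

/-- The Pfaffian form `φ_G = (−2π)^{−ℓ/2} Pf(dΛ Λ⁻¹ dΛ) / √ψ_G`. -/
noncomputable def phiForm (m n' ℓ k : ℕ) (hk : ℓ = 2 * k)
    (s t : Fin m → Fin (n' + 1)) (a : Fin m → ℝ) (C : Matrix (Fin m) (Fin ℓ) ℤ) :
    ExteriorAlgebra ℝ (Fin m → ℝ) :=
  ((((-2) * Real.pi) ^ k)⁻¹ * (Real.sqrt (psi m n' s t a))⁻¹) •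
    pfaffian hk
      (dLam C * ((cycleLap a C)⁻¹).map (algebraMap ℝ (ExteriorAlgebra ℝ (Fin m → ℝ))) *
        dLam C)

open Classical in
/-- Sum of `F T` over all spanning trees `T` of the graph. -/
noncomputable def treeSum {β : Type*} [AddCommMonoid β] (m n' : ℕ)
    (s t : Fin m → Fin (n' + 1)) (F : Finset (Fin m) → β) : β :=
  ∑ T ∈ Finset.univ.filter (fun T : Finset (Fin m) => IsSpanningTree m (n' + 1) s t T), F T

open Classical in
/-- The number of spanning trees of the graph. -/
noncomputable def treeCount (m n' : ℕ) (s t : Fin m → Fin (n' + 1)) : ℕ :=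
  (Finset.univ.filter (fun T : Finset (Fin m) => IsSpanningTree m (n' + 1) s t T)).card

/-- The summand of `α_G` corresponding to a spanning tree `T`. -/
noncomputable def alphaTerm {m n' ℓ k : ℕ} (hk : ℓ = 2 * k)
    (s t : Fin m → Fin (n' + 1)) (a : Fin m → ℝ) (T : Finset (Fin m)) :
    ExteriorAlgebra ℝ (Fin m → ℝ) :=
  if h : Tᶜ.card = ℓ then
    ((rowSub (inc ℝ m n' s t) T n').det *
        ∑ σ : Equiv.Perm (Fin ℓ), ∏ i : Fin k,
          dodgE m n' s t a
            ((Tᶜ.orderIsoOfFin h) (σ (Fin.cast hk.symm ⟨2 * i.1, by have := i.2; omega⟩)) : Fin m)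
            ((Tᶜ.orderIsoOfFin h) (σ (Fin.cast hk.symm ⟨2 * i.1 + 1, by have := i.2; omega⟩)) : Fin m)) •
      (List.ofFn fun j : Fin ℓ => θ m ((Tᶜ.orderIsoOfFin h) j : Fin m)).prod
  else 0

/-- The topological form `α_G`. -/
noncomputable def alphaForm (m n' ℓ k : ℕ) (hk : ℓ = 2 * k)
    (s t : Fin m → Fin (n' + 1)) (a : Fin m → ℝ) :
    ExteriorAlgebra ℝ (Fin m → ℝ) :=
  ((Real.pi ^ k * 4 ^ ℓ * (Nat.factorial k : ℝ) *
      psi m n' s t a ^ (((ℓ : ℝ) + 1) / 2))⁻¹) •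
    treeSum m n' s t (alphaTerm hk s t a)

/-- A walk in the graph, with signed edge traversals. -/
structure GWalk (m n : ℕ) (s t : Fin m → Fin n) (k : ℕ) where
  g : Fin k → Fin m
  ε : Fin k → ℤ
  u : Fin (k + 1) → Fin n
  hε : ∀ i, ε i = 1 ∨ ε i = -1
  hstep : ∀ i : Fin k,
    (ε i = 1 → s (g i) = u i.castSucc ∧ t (g i) = u i.succ) ∧
    (ε i = -1 → s (g i) = u i.succ ∧ t (g i) = u i.castSucc)

/-- The signed incidence vector of a walk. -/
def GWalk.vec {m n k : ℕ} {s t : Fin m → Fin n} (W : GWalk m n s t k) : Fin m → ℤ :=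
  fun e => ∑ i : Fin k, if W.g i = e then W.ε i else 0

/-- The lift of a vector along the subdivision of the edge `k` into two edges. -/
def liftVec {m : ℕ} (k : Fin m) (x : Fin m → ℤ) : Fin (m + 1) → ℤ :=
  fun i => if _ : i.1 ≤ k.1 then x ⟨i.1, by have := k.2; omega⟩
    else x ⟨i.1 - 1, by have := i.2; omega⟩


/-- The entries of the adjugate are signed minors, with the complement of a singleton
enumerated by its order isomorphism. -/
theorem det_compl_singleton_eq_adjugate {R : Type*} [CommRing R] {N : ℕ}
    (A : Matrix (Fin N) (Fin N) R) (p q : Fin N) {c : ℕ}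
    (hp : ({p}ᶜ : Finset (Fin N)).card = c) (hq : ({q}ᶜ : Finset (Fin N)).card = c) :
    Matrix.det (Matrix.of fun i j : Fin c =>
        A (({p}ᶜ : Finset (Fin N)).orderIsoOfFin hp i)
          (({q}ᶜ : Finset (Fin N)).orderIsoOfFin hq j)) =
      (-1) ^ ((p : ℕ) + (q : ℕ)) * A.adjugate q p := by
  obtain _ | N := N
  · exact p.elim0
  obtain rfl : N = c := by simpa [Finset.card_compl] using hp
  have key (r : Fin (N + 1)) (hr : ({r}ᶜ : Finset (Fin (N + 1))).card = N) (i : Fin N) :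
      (({r}ᶜ : Finset (Fin (N + 1))).orderIsoOfFin hr i : Fin (N + 1)) = r.succAbove i := by
    rw [Finset.coe_orderIsoOfFin_apply, Finset.orderEmbOfFin_compl_singleton_apply]
    simp
  rw [Matrix.adjugate_fin_succ_eq_det_submatrix, ← mul_assoc, ← pow_add,
    Even.neg_one_pow ⟨_, rfl⟩, one_mul]
  congr 1
  ext i j
  simp [key]

/-- Vertex Dodgson polynomials are signed entries of the adjugate of `𝕄`. -/
theorem dodgV_eq_adjugate (m n' : ℕ) (s t : Fin m → Fin (n' + 1)) (a : Fin m → ℝ)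
    (i j : Fin n') :
    dodgV m n' s t a i j = (-1) ^ ((i : ℕ) + (j : ℕ)) *
      (MM m n' s t a).adjugate (vtxIdx m n' j) (vtxIdx m n' i) := by
  rw [dodgV, dodgson, dif_pos (by simp), det_compl_singleton_eq_adjugate]
  congr 1
  rw [show ((vtxIdx m n' i : Fin (m + n')) : ℕ) + (vtxIdx m n' j : Fin (m + n')) =
    (m + m) + (i + j) by simp [vtxIdx]; ring, pow_add, Even.neg_one_pow ⟨m, rfl⟩, one_mul]

/-- Conjugating `𝕄` by the sign change on the vertices transposes it. -/
theorem transpose_MM (m n' : ℕ) (s t : Fin m → Fin (n' + 1)) (a : Fin m → ℝ) :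
    (MM m n' s t a)ᵀ =
      Matrix.diagonal (Fin.append (fun _ : Fin m => (1 : ℝ)) fun _ : Fin n' => -1) *
        MM m n' s t a *
        Matrix.diagonal (Fin.append (fun _ : Fin m => (1 : ℝ)) fun _ : Fin n' => -1) := by
  ext x y
  rw [Matrix.mul_diagonal, Matrix.diagonal_mul]
  induction x using Fin.addCases <;> induction y using Fin.addCases <;>
    simp [MM, Matrix.diagonal_apply]
  grind

/-- The vertex block of the adjugate of `𝕄` is symmetric. -/
theorem adjugate_MM_vtxIdx_comm (m n' : ℕ) (s t : Fin m → Fin (n' + 1)) (a : Fin m → ℝ)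
    (i j : Fin n') :
    (MM m n' s t a).adjugate (vtxIdx m n' i) (vtxIdx m n' j) =
      (MM m n' s t a).adjugate (vtxIdx m n' j) (vtxIdx m n' i) := by
  set d : Fin (m + n') → ℝ := Fin.append (fun _ => 1) fun _ => -1 with hd
  have hdd : Matrix.diagonal d * Matrix.diagonal d = 1 := by
    rw [Matrix.diagonal_mul_diagonal, ← Matrix.diagonal_one]
    congr 1
    ext x
    induction x using Fin.addCases <;> simp [hd]
  have hadj : (Matrix.diagonal d).adjugate = (Matrix.diagonal d).det • Matrix.diagonal d := by
    have := congrArg (· * Matrix.diagonal d) (Matrix.adjugate_mul (Matrix.diagonal d))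
    simpa [Matrix.mul_assoc, hdd, -Matrix.diagonal_mul_diagonal, -Matrix.det_diagonal] using this
  have hdet : (Matrix.diagonal d).det * (Matrix.diagonal d).det = 1 := by
    rw [← Matrix.det_mul, hdd, Matrix.det_one]
  have h := congrArg Matrix.adjugate (transpose_MM m n' s t a)
  rw [← hd, ← Matrix.adjugate_transpose, Matrix.adjugate_mul_distrib,
    Matrix.adjugate_mul_distrib, hadj, Matrix.mul_smul, Matrix.smul_mul, Matrix.mul_smul,
    smul_smul, hdet, one_smul, ← Matrix.mul_assoc] at h
  have h' := congrFun (congrFun h (vtxIdx m n' j)) (vtxIdx m n' i)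
  rw [Matrix.transpose_apply, Matrix.mul_diagonal, Matrix.diagonal_mul] at h'
  simpa [hd, vtxIdx] using h'

/-- Setting the Schwinger parameter of `e` to zero in `ψ_G`. -/
theorem psi_update_zero (m n' : ℕ) (s t : Fin m → Fin (n' + 1)) (a : Fin m → ℝ) (e : Fin m) :
    psi m n' s t (Function.update a e 0) = psi m n' s t a -
      a e * (MM m n' s t a).adjugate (edgeIdx m n' e) (edgeIdx m n' e) := by
  have h : MM m n' s t (Function.update a e 0) =
      (MM m n' s t a).updateRow (edgeIdx m n' e)
        (MM m n' s t a (edgeIdx m n' e) + (-a e) • Pi.single (edgeIdx m n' e) 1) := by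
    ext x y
    induction x using Fin.addCases <;> induction y using Fin.addCases <;>
      simp [MM, edgeIdx, Matrix.updateRow_apply, Matrix.diagonal_apply, Pi.single_apply,
        Function.update_apply, Fin.ext_iff] <;> grind
  rw [psi, psi, h, Matrix.det_updateRow_add, Matrix.det_updateRow_smul,
    Matrix.updateRow_eq_self, ← Matrix.adjugate_apply]
  ring

/-- **Linear relation between vertex Dodgson polynomials and contraction.**
The edge `e` has tail `v_i` and head `v_j`, distinct vertices both different from `v⋆`
(encoded via `Fin.castSucc`). -/
theorem vertex_dodgson_contraction (m n' : ℕ) (s t : Fin m → Fin (n' + 1))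
    (hconn : IsConnectedGraph m (n' + 1) s t)
    (a : Fin m → ℝ) (ha : ∀ e, 0 < a e)
    (e : Fin m) (i j : Fin n') (hi : s e = Fin.castSucc i) (hj : t e = Fin.castSucc j)
    (hij : i ≠ j) :
    a e * psi m n' s t (Function.update a e 0) =
      dodgV m n' s t a i i + dodgV m n' s t a j j -
        2 * (-1 : ℝ) ^ (((i : ℕ) + 1) + ((j : ℕ) + 1)) * dodgV m n' s t a i j := by
  set M := MM m n' s t a with hM
  set k := edgeIdx m n' e with hk
  set p := vtxIdx m n' i with hp
  set q := vtxIdx m n' j with hq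
  have row (x) : M k x = a e * (Pi.single k 1 : _ → ℝ) x + (Pi.single q 1 : _ → ℝ) x -
      (Pi.single p 1 : _ → ℝ) x := by
    induction x using Fin.addCases <;>
      simp [hM, MM, hk, hp, hq, edgeIdx, vtxIdx, inc, hi, hj, Matrix.diagonal_apply,
        Pi.single_apply, Fin.ext_iff] <;> grind
  have col (x) : M x k = a e * (Pi.single k 1 : _ → ℝ) x - (Pi.single q 1 : _ → ℝ) x +
      (Pi.single p 1 : _ → ℝ) x := by
    induction x using Fin.addCases <;>
      simp [hM, MM, hk, hp, hq, edgeIdx, vtxIdx, inc, hi, hj, Matrix.diagonal_apply,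
        Pi.single_apply, Fin.ext_iff] <;> grind
  have hrow (y) : a e * M.adjugate k y + M.adjugate q y - M.adjugate p y =
      M.det * (1 : Matrix _ _ ℝ) k y := by
    have h := congrFun (congrFun (Matrix.mul_adjugate M) k) y
    rw [Matrix.mul_apply] at h
    simpa [row, add_mul, sub_mul, Finset.sum_add_distrib, Finset.sum_sub_distrib,
      Pi.single_apply] using h
  have hcol (y) : a e * M.adjugate y k - M.adjugate y q + M.adjugate y p =
      M.det * (1 : Matrix _ _ ℝ) y k := by
    have h := congrFun (congrFun (Matrix.adjugate_mul M) y) k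
    rw [Matrix.mul_apply] at h
    simpa [col, mul_add, mul_sub, Finset.sum_add_distrib, Finset.sum_sub_distrib,
      Pi.single_apply, mul_comm] using h
  have hkp : k ≠ p := by simp [hk, hp, edgeIdx, vtxIdx, Fin.ext_iff]; omega
  have hkq : k ≠ q := by simp [hk, hq, edgeIdx, vtxIdx, Fin.ext_iff]; omega
  have hcomm : M.adjugate p q = M.adjugate q p := adjugate_MM_vtxIdx_comm m n' s t a i j
  have hrk := hrow k
  have hcp := hcol p
  have hcq := hcol q
  rw [Matrix.one_apply_eq] at hrk
  rw [Matrix.one_apply_ne hkp.symm] at hcp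
  rw [Matrix.one_apply_ne hkq.symm] at hcq
  have hsign : (-1 : ℝ) ^ ((i : ℕ) + 1 + ((j : ℕ) + 1)) * (-1) ^ ((i : ℕ) + (j : ℕ)) = 1 := by
    rw [← pow_add]
    exact Even.neg_one_pow ⟨i + j + 1, by ring⟩
  rw [psi_update_zero, dodgV_eq_adjugate, dodgV_eq_adjugate, dodgV_eq_adjugate,
    Even.neg_one_pow ⟨_, rfl⟩, Even.neg_one_pow ⟨_, rfl⟩, psi, ← hM, ← hk, ← hp, ← hq]
  linear_combination (-a e) * hrk + hcq - hcp - hcomm + 2 * M.adjugate q p * hsign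
end GraphForms
end

section
/- Cycle relation for edge Dodgson polynomials. Let G be a connected graph with positive Schwinger parameters and let c ∈ ℤ^E be any vector with 𝕀ᵀ c = 0 (for example the signed incidence vector of a cycle of G). Then for every edge index 1 ≤ i ≤ m, c_i · ψ_G = ∑_{j=1}^{m} (−1)^{i+j} c_j a_j ψ^{e_i,e_j}. -/
open Matrix BigOperators

namespace GraphForms

/-- The determinant of the matrix with row `i` and column `j` deleted is, up to sign, an entry
of the adjugate. -/
theorem det_orderIsoOfFin_compl_singleton {R : Type*} [CommRing R] {N k : ℕ}
    (M : Matrix (Fin N) (Fin N) R) (i j : Fin N)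
    (hi : (({i} : Finset (Fin N))ᶜ).card = k) (hj : (({j} : Finset (Fin N))ᶜ).card = k) :
    Matrix.det (Matrix.of fun p q : Fin k =>
        M ((({i} : Finset (Fin N))ᶜ).orderIsoOfFin hi p)
          ((({j} : Finset (Fin N))ᶜ).orderIsoOfFin hj q)) =
      (-1) ^ ((i : ℕ) + (j : ℕ)) * M.adjugate j i := by
  obtain _ | N := N
  · exact i.elim0
  obtain rfl : k = N := by simpa [Finset.card_compl] using hi.symm
  have key (p : Fin (k + 1)) (hp : (({p} : Finset (Fin (k + 1)))ᶜ).card = k) (q : Fin k) :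
      ((({p} : Finset (Fin (k + 1)))ᶜ).orderIsoOfFin hp q : Fin (k + 1)) = p.succAbove q := by
    rw [Finset.coe_orderIsoOfFin_apply, Finset.orderEmbOfFin_compl_singleton]
    rfl
  simp only [key, Matrix.adjugate_fin_succ_eq_det_submatrix, ← mul_assoc, ← mul_pow,
    neg_mul_neg, one_mul, one_pow]
  rfl

theorem dodgE_eq_adjugate (m n' : ℕ) (s t : Fin m → Fin (n' + 1)) (a : Fin m → ℝ)
    (i j : Fin m) :
    dodgE m n' s t a i j = (-1) ^ ((i : ℕ) + (j : ℕ)) *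
      (MM m n' s t a).adjugate (edgeIdx m n' j) (edgeIdx m n' i) := by
  rw [dodgE, dodgson, dif_pos (by simp)]
  exact det_orderIsoOfFin_compl_singleton _ _ _ _ _

/-- A vector `c` in the kernel of `𝕀ᵀ`, extended by zero, satisfies `(c, 0) 𝕄 = (c D, 0)`. -/
theorem vecMul_MM_append_zero (m n' : ℕ) (s t : Fin m → Fin (n' + 1)) (a : Fin m → ℝ)
    (c : Fin m → ℝ) (hc : c ᵥ* inc ℝ m n' s t = 0) :
    Fin.append c (0 : Fin n' → ℝ) ᵥ* MM m n' s t a =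
      Fin.append (fun j => c j * a j) (0 : Fin n' → ℝ) := by
  ext q
  induction q using Fin.addCases with
  | left q =>
    simp [Matrix.vecMul, dotProduct, Fin.sum_univ_add, MM, Matrix.diagonal_apply]
  | right q =>
    simpa [Matrix.vecMul, dotProduct, Fin.sum_univ_add, MM] using congrFun hc q

/-- **Cycle relation for edge Dodgson polynomials.** -/
theorem cycle_relation_edge_dodgson (m n' : ℕ) (s t : Fin m → Fin (n' + 1))
    (hconn : IsConnectedGraph m (n' + 1) s t)
    (a : Fin m → ℝ) (ha : ∀ e, 0 < a e)
    (c : Fin m → ℤ) (hc : (inc ℤ m n' s t)ᵀ.mulVec c = 0) :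
    ∀ i : Fin m,
      (c i : ℝ) * psi m n' s t a =
        ∑ j : Fin m, (-1 : ℝ) ^ (((i : ℕ) + 1) + ((j : ℕ) + 1)) * (c j : ℝ) * a j *
          dodgE m n' s t a i j := by
  intro i
  have hc' : (fun e => (c e : ℝ)) ᵥ* inc ℝ m n' s t = 0 := by
    ext v
    have h := congrArg (Int.cast : ℤ → ℝ) (congrFun hc v)
    simpa [Matrix.mulVec, Matrix.vecMul, dotProduct, inc, mul_comm] using h
  have h := congrArg (· ᵥ* (MM m n' s t a).adjugate) (vecMul_MM_append_zero m n' s t a _ hc')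
  simp only [Matrix.vecMul_vecMul, Matrix.mul_adjugate, Matrix.vecMul_smul,
    Matrix.vecMul_one] at h
  have hi := congrFun h (edgeIdx m n' i)
  simp only [Pi.smul_apply, smul_eq_mul, Matrix.vecMul, dotProduct, Fin.sum_univ_add,
    Fin.append_left, Fin.append_right, edgeIdx, Pi.zero_apply, zero_mul,
    Finset.sum_const_zero, add_zero] at hi
  rw [psi, mul_comm, hi]
  refine Finset.sum_congr rfl fun j _ => ?_
  have hsign : (-1 : ℝ) ^ (((i : ℕ) + 1) + ((j : ℕ) + 1)) * (-1) ^ ((i : ℕ) + (j : ℕ)) = 1 := by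
    rw [← pow_add]
    exact Even.neg_one_pow ⟨i + j + 1, by ring⟩
  rw [dodgE_eq_adjugate, edgeIdx, edgeIdx]
  linear_combination (-(c j : ℝ) * a j *
    (MM m n' s t a).adjugate (Fin.castAdd n' j) (Fin.castAdd n' i)) * hsign
end GraphForms
end
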